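/- (Lemma 2, KT concentration) Let t, s ∈ ℕ with 2 ≤ s ≤ t−2, and let θ be a random variable distributed according to the Beta(s + 1/2, t − s + 1/2) distribution (the KT/Jeffreys posterior after observing s successes in t Bernoulli trials), with posterior mean θ̄ := (s + 1/2)/(t + 1). Then for every ε > 0, P(|θ − θ̄| ≥ ε) ≤ [1.25·(t−1)^{3/2} / √((s − 1/2)(t − s + 1/2))] · e^{−2(t−1)ε²}. -/

import Mathlib

open MeasureTheory

/-- The Beta function `B(a,b) = Γ(a)Γ(b)/Γ(a+b)`. -/
noncomputable def betaFn (a b : ℝ) : ℝ := Real.Gamma a * Real.Gamma b / Real.Gamma (a + b)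

/-- The density of the `Beta(a,b)` distribution on `[0,1]`: `x^{a−1}(1−x)^{b−1}/B(a,b)`. -/
noncomputable def betaPDF (a b x : ℝ) : ℝ :=
  if 0 ≤ x ∧ x ≤ 1 then x ^ (a - 1) * (1 - x) ^ (b - 1) / betaFn a b else 0

/-- The `Beta(a,b)` probability measure on `ℝ` (supported on `[0,1]`). -/
noncomputable def betaMeasure (a b : ℝ) : Measure ℝ :=
  volume.withDensity fun x => ENNReal.ofReal (betaPDF a b x)

section BetaMoments

open ProbabilityTheory Set Real

theorem betaMeasure_eq (a b : ℝ) : _root_.betaMeasure a b = ProbabilityTheory.betaMeasure a b := by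
  have h0 : ∀ᵐ x : ℝ, x ≠ 0 := Measure.ae_ne volume 0
  have h1 : ∀ᵐ x : ℝ, x ≠ 1 := Measure.ae_ne volume 1
  refine withDensity_congr_ae ?_
  filter_upwards [h0, h1] with x h0 h1
  have hx : (0 ≤ x ∧ x ≤ 1) ↔ (0 < x ∧ x < 1) := by
    rw [le_iff_lt_or_eq, le_iff_lt_or_eq]
    simp [h0.symm, h1]
  simp only [_root_.betaPDF, ProbabilityTheory.betaPDF, betaPDFReal, hx, betaFn, beta]
  congr 2
  ring

theorem betaPDFReal_nonneg {a b : ℝ} (ha : 0 < a) (hb : 0 < b) (x : ℝ) :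
    0 ≤ betaPDFReal a b x := by
  by_cases hx : 0 < x ∧ x < 1
  · exact (betaPDFReal_pos hx.1 hx.2 ha hb).le
  · simp [betaPDFReal, hx]

theorem ae_mem_Icc_betaMeasure (a b : ℝ) :
    ∀ᵐ x ∂ProbabilityTheory.betaMeasure a b, x ∈ Icc (0 : ℝ) 1 := by
  rw [ProbabilityTheory.betaMeasure,
    ae_withDensity_iff (f := ProbabilityTheory.betaPDF a b)
      (measurable_betaPDFReal a b).ennreal_ofReal]
  filter_upwards with x hx
  by_contra h
  refine hx ?_
  have : ¬ (0 < x ∧ x < 1) := fun h' => h ⟨h'.1.le, h'.2.le⟩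
  simp [ProbabilityTheory.betaPDF, betaPDFReal, this]

theorem integrable_betaMeasure_of_continuous {a b : ℝ} (ha : 0 < a) (hb : 0 < b) {g : ℝ → ℝ}
    (hg : Continuous g) : Integrable g (ProbabilityTheory.betaMeasure a b) := by
  have := isProbabilityMeasureBeta ha hb
  obtain ⟨C, hC⟩ := (isCompact_Icc (a := (0 : ℝ)) (b := 1)).exists_bound_of_continuousOn
    hg.continuousOn
  refine Integrable.of_bound hg.aestronglyMeasurable C ?_
  filter_upwards [ae_mem_Icc_betaMeasure a b] with x hx using hC x hx

/-- The Stein identity for the exponential tilts of the Beta distribution. -/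
theorem integral_stein_betaMeasure {a b : ℝ} (ha : 0 < a) (hb : 0 < b) (u : ℝ) :
    ∫ x, (a - (a + b) * x + u * (x * (1 - x))) * exp (u * x)
      ∂ProbabilityTheory.betaMeasure a b = 0 := by
  set g : ℝ → ℝ := fun x => (a - (a + b) * x + u * (x * (1 - x))) * exp (u * x) with hg
  have hmeas : Measurable (ProbabilityTheory.betaPDF a b) :=
    (measurable_betaPDFReal a b).ennreal_ofReal
  have htop : ∀ᵐ x : ℝ, ProbabilityTheory.betaPDF a b x < ⊤ :=
    Filter.Eventually.of_forall fun _ => ENNReal.ofReal_lt_top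
  have hreal (x : ℝ) : (ProbabilityTheory.betaPDF a b x).toReal = betaPDFReal a b x :=
    ENNReal.toReal_ofReal (betaPDFReal_nonneg ha hb x)
  have hpg : Integrable (fun x => betaPDFReal a b x * g x) := by
    have h := integrable_betaMeasure_of_continuous ha hb (g := g) (by fun_prop)
    rw [ProbabilityTheory.betaMeasure, integrable_withDensity_iff_integrable_smul' hmeas htop] at h
    simpa only [hreal, smul_eq_mul] using h
  rw [ProbabilityTheory.betaMeasure, integral_withDensity_eq_integral_toReal_smul hmeas htop]
  simp only [hreal, smul_eq_mul]
  have hsupp : ∫ x, betaPDFReal a b x * g x = ∫ x in (0 : ℝ)..1, betaPDFReal a b x * g x := by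
    rw [intervalIntegral.integral_of_le zero_le_one, setIntegral_eq_integral_of_forall_compl_eq_zero]
    intro x hx
    have : ¬ (0 < x ∧ x < 1) := fun h' => hx ⟨h'.1, h'.2.le⟩
    simp [betaPDFReal, this]
  rw [hsupp, intervalIntegral.integral_eq_sub_of_hasDerivAt_of_le zero_le_one
    (f := fun x => 1 / beta a b * (x ^ a * (1 - x) ^ b * exp (u * x))) ?_ ?_ hpg.intervalIntegrable]
  · simp [zero_rpow ha.ne', zero_rpow hb.ne']
  · refine Continuous.continuousOn ?_
    have h1 : Continuous fun x : ℝ => x ^ a := continuous_rpow_const ha.le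
    have h2 : Continuous fun x : ℝ => (1 - x) ^ b :=
      (continuous_rpow_const hb.le).comp (by fun_prop)
    fun_prop
  · rintro x ⟨hx0, hx1⟩
    have hx1' : 0 < 1 - x := sub_pos.2 hx1
    have h1 := hasDerivAt_rpow_const (x := x) (p := a) (Or.inl hx0.ne')
    have h2 := ((hasDerivAt_id x).const_sub 1).rpow_const (p := b) (Or.inl hx1'.ne')
    have h3 := ((hasDerivAt_id x).const_mul u).exp
    refine (((h1.mul h2).mul h3).const_mul (1 / beta a b)).congr_deriv ?_
    have ea : x ^ a = x ^ (a - 1) * x := by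
      rw [← rpow_add_one hx0.ne', sub_add_cancel]
    have eb : (1 - x) ^ b = (1 - x) ^ (b - 1) * (1 - x) := by
      rw [← rpow_add_one hx1'.ne', sub_add_cancel]
    simp only [betaPDFReal, hx0, hx1, and_self, if_true, hg, id, Pi.mul_apply, ea, eb]
    ring

theorem mgf_id_betaMeasure_le {a b : ℝ} (ha : 0 < a) (hb : 0 < b) (u : ℝ) :
    mgf id (ProbabilityTheory.betaMeasure a b) u ≤
      exp (a / (a + b) * u + u ^ 2 / (8 * (a + b))) := by
  have hprob := isProbabilityMeasureBeta ha hb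
  set μ := ProbabilityTheory.betaMeasure a b
  have hn : 0 < a + b := by positivity
  set E : ℝ → ℝ := fun v => exp (-(a / (a + b) * v + v ^ 2 / (8 * (a + b)))) with hE
  set K : ℝ → ℝ := fun v => ∫ x, x * (1 - x) * exp (v * x) ∂μ with hK
  have hi {g : ℝ → ℝ} (hg : Continuous g) : Integrable g μ :=
    integrable_betaMeasure_of_continuous ha hb hg
  have hM (v : ℝ) : HasDerivAt (mgf id μ) (∫ x, x * exp (v * x) ∂μ) v := by
    refine hasDerivAt_mgf (X := id) ?_
    have : integrableExpSet id μ = univ :=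
      eq_univ_of_forall fun t => hi (g := fun x => exp (t * id x)) (by simp only [id]; fun_prop)
    simp [this]
  have hstein (v : ℝ) :
      (a + b) * ∫ x, x * exp (v * x) ∂μ = a * mgf id μ v + v * K v := by
    have h := integral_stein_betaMeasure ha hb v
    have hsplit : (fun x : ℝ => (a - (a + b) * x + v * (x * (1 - x))) * exp (v * x)) =
        fun x => (a * exp (v * x) - (a + b) * (x * exp (v * x)))
          + v * (x * (1 - x) * exp (v * x)) := by
      funext x; ring
    rw [hsplit, integral_add (hi (by fun_prop)) (hi (by fun_prop)),
      integral_sub (hi (by fun_prop)) (hi (by fun_prop)), integral_const_mul,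
      integral_const_mul, integral_const_mul] at h
    simp only [mgf, id, hK]
    linarith
  have hKle (v : ℝ) : K v ≤ mgf id μ v / 4 := by
    rw [mgf, ← integral_div]
    refine integral_mono (hi (by fun_prop)) (hi (by simp only [id]; fun_prop)) fun x => ?_
    simp only [id]
    nlinarith [mul_nonneg (sq_nonneg (x - 1 / 2)) (exp_pos (v * x)).le]
  have hG (v : ℝ) : HasDerivAt (fun v => mgf id μ v * E v)
      (v * (K v - mgf id μ v / 4) * (E v / (a + b))) v := by
    have hE' : HasDerivAt E (E v * (-(a / (a + b) + 2 * v / (8 * (a + b))))) v := by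
      refine HasDerivAt.exp ?_
      have h1 := (hasDerivAt_id v).const_mul (a / (a + b))
      have h2 := (hasDerivAt_pow 2 v).div_const (8 * (a + b))
      exact (h1.add h2).neg.congr_deriv (by simp)
    refine ((hM v).mul hE').congr_deriv ?_
    have h' : ∫ x, x * exp (v * x) ∂μ = (a * mgf id μ v + v * K v) / (a + b) := by
      rw [← hstein v, mul_div_cancel_left₀ _ hn.ne']
    rw [h']
    field_simp
    ring
  have hcont : Continuous fun v => mgf id μ v * E v :=
    continuous_iff_continuousAt.2 fun v => (hG v).continuousAt
  have hEpos (v : ℝ) : 0 < E v / (a + b) := div_pos (exp_pos _) hn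
  have hle : mgf id μ u * E u ≤ mgf id μ 0 * E 0 := by
    rcases le_total 0 u with hu | hu
    · refine antitoneOn_of_hasDerivWithinAt_nonpos (convex_Ici 0) hcont.continuousOn
        (fun v _ => (hG v).hasDerivWithinAt) (fun v hv => ?_) self_mem_Ici hu hu
      rw [interior_Ici] at hv
      exact mul_nonpos_of_nonpos_of_nonneg
        (mul_nonpos_of_nonneg_of_nonpos (le_of_lt hv) (sub_nonpos.2 (hKle v))) (hEpos v).le
    · refine monotoneOn_of_hasDerivWithinAt_nonneg (convex_Iic 0) hcont.continuousOn
        (fun v _ => (hG v).hasDerivWithinAt) (fun v hv => ?_) hu self_mem_Iic hu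
      rw [interior_Iic] at hv
      exact mul_nonneg
        (mul_nonneg_of_nonpos_of_nonpos (le_of_lt hv) (sub_nonpos.2 (hKle v))) (hEpos v).le
  have h0 : mgf id μ 0 * E 0 = 1 := by simp [hE]
  rw [h0, hE] at hle
  simp only [exp_neg] at hle
  rwa [mul_inv_le_iff₀ (exp_pos _), one_mul] at hle

/-- The `Beta(a,b)` distribution is sub-Gaussian with variance proxy `1 / (4 (a + b))`. -/
theorem hasSubgaussianMGF_betaMeasure {a b : ℝ} (ha : 0 < a) (hb : 0 < b) :
    HasSubgaussianMGF (fun x => x - a / (a + b)) (Real.toNNReal (1 / (4 * (a + b))))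
      (ProbabilityTheory.betaMeasure a b) where
  integrable_exp_mul t := integrable_betaMeasure_of_continuous ha hb (by fun_prop)
  mgf_le t := by
    have hn : 0 < a + b := by positivity
    have h : mgf (fun x => x - a / (a + b)) (ProbabilityTheory.betaMeasure a b) t =
        mgf id (ProbabilityTheory.betaMeasure a b) t * exp (-(a / (a + b) * t)) := by
      rw [mgf, mgf, ← integral_mul_const]
      congr 1
      funext x
      rw [← exp_add]
      simp only [id]
      ring_nf
    rw [h, Real.coe_toNNReal _ (by positivity)]
    calc _ ≤ exp (a / (a + b) * t + t ^ 2 / (8 * (a + b))) * exp (-(a / (a + b) * t)) := by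
          gcongr; exact mgf_id_betaMeasure_le ha hb t
      _ = _ := by
          rw [← exp_add]
          congr 1
          field_simp
          ring

theorem betaMeasure_real_abs_sub_mean_ge_le {a b ε : ℝ} (ha : 0 < a) (hb : 0 < b) (hε : 0 ≤ ε) :
    (ProbabilityTheory.betaMeasure a b).real {x | |x - a / (a + b)| ≥ ε} ≤
      2 * exp (-2 * ((a + b) * ε ^ 2)) := by
  have hprob := isProbabilityMeasureBeta ha hb
  have hn : 0 < a + b := by positivity
  have hX := hasSubgaussianMGF_betaMeasure ha hb
  have hexp : -ε ^ 2 / (2 * (Real.toNNReal (1 / (4 * (a + b))) : ℝ)) =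
      -2 * ((a + b) * ε ^ 2) := by
    rw [Real.coe_toNNReal _ (by positivity)]
    field_simp
    ring
  have h1 := hX.measure_ge_le hε
  have h2 := hX.neg.measure_ge_le hε
  rw [hexp] at h1 h2
  have hset : {x : ℝ | |x - a / (a + b)| ≥ ε} =
      {x | ε ≤ x - a / (a + b)} ∪ {x | ε ≤ (-fun x => x - a / (a + b)) x} := by
    ext x
    simp [le_abs]
  rw [hset]
  linarith [measureReal_union_le (μ := ProbabilityTheory.betaMeasure a b)
    {x | ε ≤ x - a / (a + b)} {x | ε ≤ (-fun x => x - a / (a + b)) x}]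

end BetaMoments

theorem two_le_concentration_prefactor {s t : ℝ} (hs : 1 / 2 < s) (hst : s ≤ t) (ht : 4 ≤ t) :
    2 ≤ 1.25 * (t - 1) ^ ((3 : ℝ) / 2) / Real.sqrt ((s - 1 / 2) * (t - s + 1 / 2)) := by
  have hpos : 0 < (s - 1 / 2) * (t - s + 1 / 2) := mul_pos (by linarith) (by linarith)
  rw [le_div_iff₀ (Real.sqrt_pos.2 hpos)]
  have hsqrt : Real.sqrt ((s - 1 / 2) * (t - s + 1 / 2)) ≤ t / 2 := by
    refine Real.sqrt_le_iff.2 ⟨by linarith, ?_⟩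
    nlinarith [sq_nonneg ((s - 1 / 2) - (t - s + 1 / 2))]
  have hpow : (t - 1) ^ ((3 : ℝ) / 2) = (t - 1) * Real.sqrt (t - 1) := by
    rw [Real.sqrt_eq_rpow, ← Real.rpow_one_add' (by linarith) (by norm_num)]
    norm_num
  have hroot : 3 / 2 ≤ Real.sqrt (t - 1) := Real.le_sqrt_of_sq_le (by linarith)
  rw [hpow]
  nlinarith

/-- **Lemma 2 (KT concentration).** Let `2 ≤ s ≤ t − 2` and let `θ ∼ Beta(s + 1/2, t − s + 1/2)`
(the KT/Jeffreys posterior after `s` successes in `t` Bernoulli trials), with posterior mean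
`θ̄ = (s + 1/2)/(t + 1)`.  Then for every `ε > 0`,
`P(|θ − θ̄| ≥ ε) ≤ [1.25·(t−1)^{3/2} / √((s−1/2)(t−s+1/2))] · e^{−2(t−1)ε²}`. -/
theorem kt_concentration (t s : ℕ) (hs : 2 ≤ s) (hst : s + 2 ≤ t) (ε : ℝ) (hε : 0 < ε) :
    betaMeasure ((s : ℝ) + 1 / 2) ((t : ℝ) - (s : ℝ) + 1 / 2)
        {x : ℝ | |x - ((s : ℝ) + 1 / 2) / ((t : ℝ) + 1)| ≥ ε} ≤
      ENNReal.ofReal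
        (1.25 * ((t : ℝ) - 1) ^ ((3 : ℝ) / 2) /
            Real.sqrt (((s : ℝ) - 1 / 2) * ((t : ℝ) - (s : ℝ) + 1 / 2)) *
          Real.exp (-2 * (((t : ℝ) - 1) * ε ^ 2))) := by
  have hs' : (2 : ℝ) ≤ s := by exact_mod_cast hs
  have hst' : (s : ℝ) + 2 ≤ t := by exact_mod_cast hst
  have ha : (0 : ℝ) < (s : ℝ) + 1 / 2 := by linarith
  have hb : (0 : ℝ) < (t : ℝ) - s + 1 / 2 := by linarith
  have hprob := ProbabilityTheory.isProbabilityMeasureBeta ha hb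
  have htail := betaMeasure_real_abs_sub_mean_ge_le ha hb hε.le
  have hab : (s : ℝ) + 1 / 2 + ((t : ℝ) - s + 1 / 2) = t + 1 := by ring
  rw [hab] at htail
  rw [betaMeasure_eq, ← ofReal_measureReal]
  refine ENNReal.ofReal_le_ofReal (htail.trans ?_)
  have hpre := two_le_concentration_prefactor (s := s) (t := t) (by linarith) (by linarith)
    (by linarith)
  have hexp : Real.exp (-2 * (((t : ℝ) + 1) * ε ^ 2)) ≤
      Real.exp (-2 * (((t : ℝ) - 1) * ε ^ 2)) :=
    Real.exp_le_exp.2 (by nlinarith [sq_nonneg ε])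
  exact mul_le_mul hpre hexp (Real.exp_pos _).le (zero_le_two.trans hpre)
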